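/- Let d ≥ 1 and let p ∈ [0,1] with p < p_c(d). Then there exists a constant c = c(p,d) > 0 such that for every integer L ≥ 1, π_p({ξ : there is a finite connected path of open sites in ξ from the origin to ∂B(L) := B(L) ∖ B(L−1)}) ≤ exp(−c·L). -/

import Mathlib

open MeasureTheory

namespace VoterPerc

abbrev Site (d : ℕ) := Fin d → ℤ
abbrev Config (d : ℕ) := Site d → Bool

/-- ℓ∞ distance between two sites. -/
def dinf {d : ℕ} (x y : Site d) : ℕ := Finset.univ.sup fun i => (x i - y i).natAbs

/-- ℓ¹ distance between two sites. -/
def d1 {d : ℕ} (x y : Site d) : ℕ := ∑ i, (x i - y i).natAbs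

/-- The ℓ∞ ball of (integer) radius `r` centred at `c`. -/
def ball {d : ℕ} (c : Site d) (r : ℤ) : Set (Site d) := {y | (dinf y c : ℤ) ≤ r}

/-- Translation of configurations: `(translate z ξ) y = ξ (y - z)`. -/
def translate {d : ℕ} (z : Site d) (ξ : Config d) : Config d := fun y => ξ (y - z)

/-- The percolation event: there is an infinite nearest-neighbour path of distinct open sites. -/
def Perc (d : ℕ) : Set (Config d) :=
  {ξ | ∃ γ : ℕ → Site d, Function.Injective γ ∧
    (∀ n, d1 (γ n) (γ (n + 1)) = 1) ∧ (∀ n, ξ (γ n) = true)}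

/-- `StarCross ξ A B`: there is a finite `*`-connected path of `ξ`-open sites from a
`*`-neighbour of a point of `A` to a `*`-neighbour of a point of `B`. -/
def StarCross {d : ℕ} (ξ : Config d) (A B : Set (Site d)) : Prop :=
  ∃ (n : ℕ) (γ : ℕ → Site d),
    (∃ a ∈ A, dinf (γ 0) a = 1) ∧ (∃ b ∈ B, dinf (γ n) b = 1) ∧
    (∀ i < n, dinf (γ i) (γ (i + 1)) = 1) ∧ (∀ i ≤ n, ξ (γ i) = true)

/-- `μ` is the Bernoulli(`p`) product measure on `{0,1}^{ℤ^d}`: a probability measure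
whose cylinder probabilities are the i.i.d. Bernoulli(`p`) ones. -/
def IsBernoulliProduct (d : ℕ) (p : ℝ) (μ : Measure (Config d)) : Prop :=
  IsProbabilityMeasure μ ∧
    ∀ (S : Finset (Site d)) (η : Site d → Bool),
      μ {ξ : Config d | ∀ x ∈ S, ξ x = η x} =
        ∏ x ∈ S, ENNReal.ofReal (if η x = true then p else 1 - p)

/-! ### Finite Bernoulli expectations -/

section Expect

open Classical in
/-- Indicator of a proposition. -/
noncomputable def ind (P : Prop) : ℝ := if P then 1 else 0

lemma ind_true {P : Prop} (h : P) : ind P = 1 := by simp [ind, h]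
lemma ind_false {P : Prop} (h : ¬ P) : ind P = 0 := by simp [ind, h]
lemma ind_nonneg (P : Prop) : 0 ≤ ind P := by unfold ind; split_ifs <;> norm_num
lemma ind_le_one (P : Prop) : ind P ≤ 1 := by unfold ind; split_ifs <;> norm_num
lemma ind_mono {P Q : Prop} (h : P → Q) : ind P ≤ ind Q := by
  by_cases hP : P
  · rw [ind_true hP, ind_true (h hP)]
  · rw [ind_false hP]; exact ind_nonneg _
lemma ind_congr {P Q : Prop} (h : P ↔ Q) : ind P = ind Q := by rw [propext h]

variable {V : Type*} [DecidableEq V]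

/-- Expectation of `f` of the random open set in the finite volume `Λ`. -/
noncomputable def EE (p : ℝ) (Λ : Finset V) (f : Finset V → ℝ) : ℝ :=
  ∑ A ∈ Λ.powerset, p ^ A.card * (1 - p) ^ (Λ \ A).card * f A

lemma EE_congr {p : ℝ} {Λ : Finset V} {f g : Finset V → ℝ} (h : ∀ A, A ⊆ Λ → f A = g A) :
    EE p Λ f = EE p Λ g := by
  unfold EE
  exact Finset.sum_congr rfl fun A hA => by rw [h A (Finset.mem_powerset.1 hA)]

lemma EE_mono {p : ℝ} (hp : p ∈ Set.Icc (0:ℝ) 1) {Λ : Finset V} {f g : Finset V → ℝ}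
    (h : ∀ A, A ⊆ Λ → f A ≤ g A) : EE p Λ f ≤ EE p Λ g := by
  unfold EE
  refine Finset.sum_le_sum fun A hA => ?_
  refine mul_le_mul_of_nonneg_left (h A (Finset.mem_powerset.1 hA)) ?_
  exact mul_nonneg (pow_nonneg hp.1 _) (pow_nonneg (by linarith [hp.2]) _)

lemma EE_add (p : ℝ) (Λ : Finset V) (f g : Finset V → ℝ) :
    EE p Λ (fun A => f A + g A) = EE p Λ f + EE p Λ g := by
  simp only [EE, mul_add, Finset.sum_add_distrib]

lemma EE_sub (p : ℝ) (Λ : Finset V) (f g : Finset V → ℝ) :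
    EE p Λ (fun A => f A - g A) = EE p Λ f - EE p Λ g := by
  simp only [EE, mul_sub, Finset.sum_sub_distrib]

lemma EE_mul_left (p : ℝ) (Λ : Finset V) (c : ℝ) (f : Finset V → ℝ) :
    EE p Λ (fun A => c * f A) = c * EE p Λ f := by
  simp only [EE, Finset.mul_sum]
  exact Finset.sum_congr rfl fun A _ => by ring

lemma EE_mul_right (p : ℝ) (Λ : Finset V) (c : ℝ) (f : Finset V → ℝ) :
    EE p Λ (fun A => f A * c) = EE p Λ f * c := by
  simp only [EE, Finset.sum_mul]
  exact Finset.sum_congr rfl fun A _ => by ring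

lemma EE_sum {ι : Type*} (p : ℝ) (Λ : Finset V) (s : Finset ι) (f : ι → Finset V → ℝ) :
    EE p Λ (fun A => ∑ i ∈ s, f i A) = ∑ i ∈ s, EE p Λ (f i) := by
  simp only [EE, Finset.mul_sum]
  exact Finset.sum_comm

lemma EE_insert (p : ℝ) {Λ : Finset V} {a : V} (ha : a ∉ Λ) (f : Finset V → ℝ) :
    EE p (insert a Λ) f = (1 - p) * EE p Λ f + p * EE p Λ (fun A => f (insert a A)) := by
  unfold EE
  rw [Finset.sum_powerset_insert ha, Finset.mul_sum, Finset.mul_sum]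
  congr 1
  · refine Finset.sum_congr rfl fun A hA => ?_
    have hA' := Finset.mem_powerset.1 hA
    have haA : a ∉ A := fun h => ha (hA' h)
    rw [Finset.insert_sdiff_of_notMem _ haA, Finset.card_insert_of_notMem (by simp [ha])]
    ring
  · refine Finset.sum_congr rfl fun A hA => ?_
    have hA' := Finset.mem_powerset.1 hA
    have haA : a ∉ A := fun h => ha (hA' h)
    have : insert a Λ \ insert a A = Λ \ A := by
      ext x; simp only [Finset.mem_sdiff, Finset.mem_insert]
      constructor
      · rintro ⟨h1 | h1, h2⟩
        · exact absurd (Or.inl h1) h2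
        · exact ⟨h1, fun h => h2 (Or.inr h)⟩
      · rintro ⟨h1, h2⟩
        refine ⟨Or.inr h1, ?_⟩
        rintro (h | h)
        · exact ha (h ▸ h1)
        · exact h2 h
    rw [this, Finset.card_insert_of_notMem haA]
    ring

lemma EE_const (p : ℝ) (Λ : Finset V) (c : ℝ) : EE p Λ (fun _ => c) = c := by
  induction Λ using Finset.induction_on with
  | empty => simp [EE]
  | insert a s ha ih => rw [EE_insert p ha, ih]; ring

lemma EE_nonneg {p : ℝ} (hp : p ∈ Set.Icc (0:ℝ) 1) {Λ : Finset V} {f : Finset V → ℝ}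
    (h : ∀ A, A ⊆ Λ → 0 ≤ f A) : 0 ≤ EE p Λ f := by
  rw [← EE_const p Λ 0]; exact EE_mono hp h

lemma EE_union (p : ℝ) {S T : Finset V} (h : Disjoint S T) (f : Finset V → ℝ) :
    EE p (S ∪ T) f = EE p S (fun A => EE p T (fun B => f (A ∪ B))) := by
  induction S using Finset.induction_on generalizing f with
  | empty => simp [EE]
  | insert a s ha ih =>
    rw [Finset.disjoint_insert_left] at h
    rw [Finset.insert_union, EE_insert p (by simp [ha, h.1]), EE_insert p ha, ih h.2, ih h.2]
    simp only [Finset.insert_union]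

lemma EE_indep (p : ℝ) {Λ S : Finset V} (hS : S ⊆ Λ) (f g : Finset V → ℝ)
    (hf : ∀ A, A ⊆ Λ → f A = f (A ∩ S)) (hg : ∀ A, A ⊆ Λ → g A = g (A \ S)) :
    EE p Λ (fun A => f A * g A) = EE p S f * EE p Λ g := by
  have hu : S ∪ (Λ \ S) = Λ := Finset.union_sdiff_of_subset hS
  have hd : Disjoint S (Λ \ S) := Finset.disjoint_sdiff
  have e1 : ∀ A, A ⊆ S → ∀ B, B ⊆ Λ \ S → (A ∪ B) ∩ S = A ∧ (A ∪ B) \ S = B ∧ A ∪ B ⊆ Λ := by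
    intro A hA B hB
    refine ⟨?_, ?_, ?_⟩
    · ext x
      have := @hA x; have := @hB x
      simp only [Finset.mem_inter, Finset.mem_union, Finset.mem_sdiff] at *
      tauto
    · ext x
      have := @hA x; have := @hB x
      simp only [Finset.mem_union, Finset.mem_sdiff] at *
      tauto
    · exact Finset.union_subset (hA.trans hS) (hB.trans Finset.sdiff_subset)
  have e2 : EE p Λ g = EE p (Λ \ S) g := by
    conv_lhs => rw [← hu]
    rw [EE_union p hd]
    rw [EE_congr (g := fun _ => EE p (Λ \ S) g), EE_const]
    intro A hA
    refine EE_congr fun B hB => ?_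
    obtain ⟨h1, h2, h3⟩ := e1 A hA B hB
    rw [hg _ h3, h2]
  rw [e2]
  conv_lhs => rw [← hu]
  rw [EE_union p hd, ← EE_mul_right]
  refine EE_congr fun A hA => ?_
  rw [← EE_mul_left]
  refine EE_congr fun B hB => ?_
  obtain ⟨h1, h2, h3⟩ := e1 A hA B hB
  rw [hg _ h3, h2, hf _ h3, h1]

lemma EE_restrict (p : ℝ) {Λ S : Finset V} (hS : S ⊆ Λ) (f : Finset V → ℝ)
    (hf : ∀ A, A ⊆ Λ → f A = f (A ∩ S)) : EE p Λ f = EE p S f := by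
  have := EE_indep p hS f (fun _ => 1) hf (fun _ _ => rfl)
  simpa [EE_const] using this

lemma EE_map {W : Type*} [DecidableEq W] (p : ℝ) (Λ : Finset V) (e : V ↪ W) (f : Finset W → ℝ) :
    EE p (Λ.map e) f = EE p Λ (fun A => f (A.map e)) := by
  induction Λ using Finset.induction_on generalizing f with
  | empty => simp [EE]
  | insert a s ha ih =>
    rw [Finset.map_insert, EE_insert p (by simpa using ha), EE_insert p ha, ih, ih]
    simp only [Finset.map_insert]

/-- Russo formula. -/
lemma EE_russo (p : ℝ) (Λ : Finset V) (f : Finset V → ℝ) :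
    HasDerivAt (fun t => EE t Λ f)
      (∑ x ∈ Λ, EE p Λ (fun A => f (insert x A) - f (A.erase x))) p := by
  induction Λ using Finset.induction_on generalizing f with
  | empty => simpa [EE] using hasDerivAt_const p (f ∅)
  | insert a s ha ih =>
    have h0 : (fun t => EE t (insert a s) f) =
        fun t => (1 - t) * EE t s f + t * EE t s (fun A => f (insert a A)) := by
      funext t; exact EE_insert t ha f
    rw [h0]
    have h1 := (((hasDerivAt_id p).const_sub 1).mul (ih f)).add
      ((hasDerivAt_id p).mul (ih (fun A => f (insert a A))))
    refine h1.congr_deriv ?_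
    rw [Finset.sum_insert ha]
    have e1 : EE p (insert a s) (fun A => f (insert a A) - f (A.erase a)) =
        EE p s (fun A => f (insert a A)) - EE p s f := by
      rw [EE_insert p ha, ← EE_sub]
      have : EE p s (fun A => f (insert a A) - f (A.erase a)) =
        EE p s (fun A => f (insert a A) - f A) := EE_congr fun A hA => by
          rw [Finset.erase_eq_of_notMem (fun h => ha (hA h))]
      rw [this]
      have : EE p s (fun A => f (insert a (insert a A)) - f ((insert a A).erase a)) =
        EE p s (fun A => f (insert a A) - f A) := EE_congr fun A hA => by
          rw [Finset.erase_insert (fun h => ha (hA h)), Finset.insert_idem]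
      rw [this]; ring
    have e2 : ∀ x ∈ s, EE p (insert a s) (fun A => f (insert x A) - f (A.erase x)) =
        (1 - p) * EE p s (fun A => f (insert x A) - f (A.erase x)) +
        p * EE p s (fun A => f (insert a (insert x A)) - f (insert a (A.erase x))) := by
      intro x hx
      rw [EE_insert p ha]
      congr 2
      refine EE_congr fun A hA => ?_
      rw [Finset.insert_comm, Finset.erase_insert_of_ne (by rintro rfl; exact ha hx)]
    rw [e1, Finset.sum_congr rfl e2, Finset.sum_add_distrib, ← Finset.mul_sum, ← Finset.mul_sum]
    simp only [id]
    ring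

lemma EE_mono_p {f : Finset V → ℝ} (hf : ∀ A B, A ⊆ B → f A ≤ f B) (Λ : Finset V)
    {p q : ℝ} (hp : 0 ≤ p) (hpq : p ≤ q) (hq : q ≤ 1) : EE p Λ f ≤ EE q Λ f := by
  have : MonotoneOn (fun t => EE t Λ f) (Set.Icc p q) := by
    refine monotoneOn_of_deriv_nonneg (convex_Icc p q)
      (fun t _ => (EE_russo t Λ f).continuousAt.continuousWithinAt)
      (fun t _ => (EE_russo t Λ f).differentiableAt.differentiableWithinAt) ?_
    intro t ht
    rw [interior_Icc] at ht
    rw [(EE_russo t Λ f).deriv]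
    refine Finset.sum_nonneg fun x _ => EE_nonneg ⟨by linarith [ht.1], by linarith [ht.2]⟩ ?_
    intro A _
    have := hf (A.erase x) (insert x A) ((Finset.erase_subset _ _).trans (Finset.subset_insert _ _))
    linarith
  exact this ⟨le_rfl, hpq⟩ ⟨hpq, le_rfl⟩ hpq

/-- Closed pivotality. -/
lemma EE_pivotal (p : ℝ) {Λ : Finset V} {x : V} (hx : x ∈ Λ) (f : Finset V → ℝ) :
    (1 - p) * EE p Λ (fun A => f (insert x A) - f (A.erase x)) =
      EE p Λ (fun A => ind (x ∉ A) * (f (insert x A) - f A)) := by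
  have h1 := EE_indep p (Λ := Λ) (S := {x}) (by simpa using hx) (fun A => ind (x ∉ A))
    (fun A => f (insert x A) - f (A.erase x)) (fun A _ => ind_congr (by simp))
    (fun A _ => by
      congr 2
      · ext y; by_cases h : y = x <;> simp [h]
      · ext y; by_cases h : y = x <;> simp [h])
  have h2 : EE p ({x} : Finset V) (fun A => ind (x ∉ A)) = 1 - p := by
    have := EE_insert p (Finset.notMem_empty x) (fun A => ind (x ∉ A))
    rw [← Finset.insert_empty, this]
    simp [EE, ind]
  rw [h2] at h1
  rw [← h1]
  refine EE_congr fun A _ => ?_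
  by_cases h : x ∈ A
  · simp [ind, h]
  · rw [Finset.erase_eq_of_notMem h]

end Expect

/-! ### Connectivity -/

section Graph

variable {V : Type*}

/-- Sites reachable from `T` through sites of `ω` (all sites of the path being in `ω`). -/
inductive Reach (nbr : V → Finset V) (ω T : Set V) : V → Prop
  | base {t : V} : t ∈ T → t ∈ ω → Reach nbr ω T t
  | step {y z : V} : Reach nbr ω T y → z ∈ nbr y → z ∈ ω → Reach nbr ω T z

variable {nbr : V → Finset V}

lemma Reach.mem {ω T : Set V} {x : V} (h : Reach nbr ω T x) : x ∈ ω := by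
  cases h <;> assumption

lemma Reach.mono {ω ω' T : Set V} (hω : ω ⊆ ω') {x : V} (h : Reach nbr ω T x) :
    Reach nbr ω' T x := by
  induction h with
  | base h1 h2 => exact .base h1 (hω h2)
  | step _ h2 h3 ih => exact .step ih h2 (hω h3)

lemma Reach.trans {ω T : Set V} {x y : V} (h1 : Reach nbr ω T x) (h : Reach nbr ω {x} y) :
    Reach nbr ω T y := by
  induction h with
  | base h _ => rw [Set.mem_singleton_iff.1 h]; exact h1
  | step _ h2 h3 ih => exact .step ih h2 h3

lemma Reach.symm (hs : ∀ x y, y ∈ nbr x → x ∈ nbr y) {ω : Set V} {x y : V}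
    (h : Reach nbr ω {x} y) : Reach nbr ω {y} x := by
  induction h with
  | base h h' => rw [Set.mem_singleton_iff.1 h] at h' ⊢; exact .base rfl h'
  | step h1 h2 h3 ih => exact Reach.trans (.step (.base rfl h3) (hs _ _ h2) h1.mem) ih

lemma Reach.exists_source {ω T : Set V} {y : V} (h : Reach nbr ω T y) :
    ∃ t ∈ T, Reach nbr ω {t} y := by
  induction h with
  | base h h' => exact ⟨_, h, .base rfl h'⟩
  | step h1 h2 h3 ih =>
    obtain ⟨t, ht, h⟩ := ih
    exact ⟨t, ht, .step h h2 h3⟩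

lemma Reach.of_source {ω T : Set V} {t y : V} (ht : t ∈ T) (h : Reach nbr ω {t} y) :
    Reach nbr ω T y := by
  induction h with
  | base h h' => rw [Set.mem_singleton_iff.1 h] at h' ⊢; exact .base ht h'
  | step _ h2 h3 ih => exact .step ih h2 h3

lemma Reach.start_mem {ω : Set V} {t y : V} (h : Reach nbr ω {t} y) : t ∈ ω := by
  induction h with
  | base h h' => rw [Set.mem_singleton_iff.1 h] at h'; exact h'
  | step _ _ _ ih => exact ih

/-- Exploration: the reached set is determined by the states of the explored sites. -/
lemma Reach.explore {ω ω' T : Set V}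
    (h : ∀ x, (x ∈ T ∨ Reach nbr ω T x ∨ ∃ z, Reach nbr ω T z ∧ x ∈ nbr z) → (x ∈ ω ↔ x ∈ ω'))
    (x : V) : Reach nbr ω T x ↔ Reach nbr ω' T x := by
  constructor
  · intro hx
    induction hx with
    | base h1 h2 => exact .base h1 ((h _ (Or.inl h1)).1 h2)
    | step h1 h2 h3 ih => exact .step ih h2 ((h _ (Or.inr (Or.inr ⟨_, h1, h2⟩))).1 h3)
  · intro hx
    induction hx with
    | base h1 h2 => exact .base h1 ((h _ (Or.inl h1)).2 h2)
    | step _ h2 h3 ih => exact .step ih h2 ((h _ (Or.inr (Or.inr ⟨_, ih, h2⟩))).2 h3)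

variable [DecidableEq V]

/-- Outer boundary. -/
def bdry (nbr : V → Finset V) (S : Finset V) : Finset V := S.biUnion nbr \ S

/-- `y` is adjacent to the cluster of `o` in `S`. -/
def QQ (nbr : V → Finset V) (o : V) (S : Finset V) (y : V) (A : Finset V) : Prop :=
  ∃ x, Reach nbr (↑(A ∩ S)) {o} x ∧ y ∈ nbr x

/-- The Duminil-Copin–Tassion functional. -/
noncomputable def phi (nbr : V → Finset V) (o : V) (p : ℝ) (S : Finset V) : ℝ :=
  ∑ y ∈ bdry nbr S, EE p S (fun A => ind (QQ nbr o S y A))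

lemma QQ_mono {o : V} {S : Finset V} {y : V} {A B : Finset V} (h : A ⊆ B)
    (hA : QQ nbr o S y A) : QQ nbr o S y B := by
  obtain ⟨x, hx, hy⟩ := hA
  exact ⟨x, hx.mono (by exact_mod_cast Finset.inter_subset_inter_right h), hy⟩

lemma phi_mono {o : V} {S : Finset V} {p q : ℝ} (hp : 0 ≤ p) (hpq : p ≤ q) (hq : q ≤ 1) :
    phi nbr o p S ≤ phi nbr o q S :=
  Finset.sum_le_sum fun _ _ => EE_mono_p (fun _ _ h => ind_mono (QQ_mono h)) _ hp hpq hq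

lemma phi_nonneg {o : V} {S : Finset V} {p : ℝ} (hp : p ∈ Set.Icc (0:ℝ) 1) :
    0 ≤ phi nbr o p S :=
  Finset.sum_nonneg fun _ _ => EE_nonneg hp fun _ _ => ind_nonneg _

open Classical in
/-- Sites of `Λ` neither reached from `T` nor adjacent to a reached site. -/
noncomputable def inner (nbr : V → Finset V) (Λ T A : Finset V) : Finset V :=
  Λ.filter fun x => x ∉ T ∧ ¬ Reach nbr A T x ∧ ∀ z, Reach nbr A T z → x ∉ nbr z

lemma inner_indep {Λ T S A : Finset V} (hA : A ⊆ Λ) :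
    inner nbr Λ T A = S ↔ inner nbr Λ T (A \ S) = S := by
  classical
  have key : ∀ A A' : Finset V, A ⊆ Λ → A' ⊆ Λ → inner nbr Λ T A = S →
      (∀ x, x ∉ S → (x ∈ A ↔ x ∈ A')) → inner nbr Λ T A' = S := by
    intro A A' hA hA' h hAA
    have hr : ∀ x, Reach nbr (A : Set V) T x ↔ Reach nbr (A' : Set V) T x := by
      intro x
      refine Reach.explore ?_ x
      intro x hx
      by_cases hxΛ : x ∈ Λ
      · have hxS : x ∉ S := by
          rw [← h]
          unfold inner
          rw [Finset.mem_filter]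
          rintro ⟨_, h1, h2, h3⟩
          rcases hx with hx | hx | ⟨z, hz, hx⟩
          · exact h1 (by exact_mod_cast hx)
          · exact h2 hx
          · exact h3 z hz hx
        exact_mod_cast hAA x hxS
      · have h1 : x ∉ A := fun h => hxΛ (hA h)
        have h2 : x ∉ A' := fun h => hxΛ (hA' h)
        simp [h1, h2]
    rw [← h]
    ext x
    simp only [inner, Finset.mem_filter, hr]
  constructor
  · intro h
    exact key A (A \ S) hA (Finset.sdiff_subset.trans hA) h (fun x hx => by simp [hx])
  · intro h
    exact key (A \ S) A (Finset.sdiff_subset.trans hA) hA h (fun x hx => by simp [hx])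

lemma dct_ineq (hs : ∀ x y, y ∈ nbr x → x ∈ nbr y) {Λ T : Finset V} {o : V} (ho : o ∈ Λ)
    (hΛ : ∀ x ∈ Λ, x ∉ T → nbr x ⊆ Λ) {p : ℝ} (hp : p ∈ Set.Icc (0:ℝ) 1)
    (hφ : ∀ S : Finset V, o ∈ S → 1 ≤ phi nbr o p S) :
    1 - EE p Λ (fun A => ind (Reach nbr A T o)) ≤
      ∑ y ∈ Λ, EE p Λ (fun A => ind (y ∉ A) *
        (ind (Reach nbr ↑(insert y A) T o) - ind (Reach nbr A T o))) := by
  classical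
  set 𝒮 := inner nbr Λ T with h𝒮
  set F := Λ.powerset.filter (fun S => o ∈ S) with hF
  have h𝒮Λ : ∀ A, 𝒮 A ⊆ Λ := fun A => Finset.filter_subset _ _
  have step1 : 1 - EE p Λ (fun A => ind (Reach nbr A T o)) =
      EE p Λ (fun A => ind (¬ Reach nbr A T o ∧ o ∉ 𝒮 A)) +
        ∑ S ∈ F, EE p Λ (fun A => ind (𝒮 A = S)) := by
    rw [← EE_sum, ← EE_add, ← EE_const p Λ 1, ← EE_sub]
    refine EE_congr fun A hA => ?_
    by_cases hoS : o ∈ 𝒮 A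
    · have hR : ¬ Reach nbr A T o := (Finset.mem_filter.1 hoS).2.2.1
      rw [ind_false hR, ind_false (by tauto), Finset.sum_eq_single (𝒮 A)]
      · rw [ind_true rfl]; ring
      · intro S _ hne; exact ind_false (Ne.symm hne)
      · intro h; exact absurd (by simp [hF, hoS, h𝒮Λ]) h
    · rw [Finset.sum_eq_zero]
      · by_cases hR : Reach nbr A T o
        · rw [ind_true hR, ind_false (by tauto)]; ring
        · rw [ind_false hR, ind_true (by tauto)]; ring
      · intro S hS
        refine ind_false ?_
        rintro rfl
        exact hoS (Finset.mem_filter.1 hS).2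
  have step2 : ∀ S ∈ F, EE p Λ (fun A => ind (𝒮 A = S)) ≤
      ∑ y ∈ bdry nbr S, EE p Λ (fun A => ind (QQ nbr o S y A) * ind (𝒮 A = S)) := by
    intro S hS
    have hSΛ : S ⊆ Λ := by simpa using (Finset.mem_filter.1 hS).1
    have hoS : o ∈ S := (Finset.mem_filter.1 hS).2
    have : ∀ y ∈ bdry nbr S, EE p Λ (fun A => ind (QQ nbr o S y A) * ind (𝒮 A = S)) =
        EE p S (fun A => ind (QQ nbr o S y A)) * EE p Λ (fun A => ind (𝒮 A = S)) := by
      intro y _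
      refine EE_indep p hSΛ _ _ (fun A _ => ?_) (fun A hA => ind_congr (inner_indep hA))
      unfold QQ
      rw [Finset.inter_assoc, Finset.inter_self]
    rw [Finset.sum_congr rfl this, ← Finset.sum_mul]
    have h0 : 0 ≤ EE p Λ (fun A => ind (𝒮 A = S)) := EE_nonneg hp fun _ _ => ind_nonneg _
    have := hφ S hoS
    unfold phi at this
    nlinarith
  rw [step1]
  refine (add_le_add_right (Finset.sum_le_sum step2) _).trans ?_
  simp only [← EE_sum]
  rw [← EE_add]
  refine EE_mono hp fun A hA => ?_
  have hterm : ∀ y, 0 ≤ ind (y ∉ A) *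
      (ind (Reach nbr ↑(insert y A) T o) - ind (Reach nbr A T o)) := by
    intro y
    refine mul_nonneg (ind_nonneg _) (sub_nonneg.2 (ind_mono fun h => h.mono ?_))
    exact_mod_cast Finset.subset_insert _ _
  by_cases hR : Reach nbr A T o
  · have hoS : o ∉ 𝒮 A := fun h => (Finset.mem_filter.1 h).2.2.1 hR
    rw [ind_false (by tauto), Finset.sum_eq_zero]
    · rw [zero_add]; exact Finset.sum_nonneg fun y _ => hterm y
    · intro S hS
      refine Finset.sum_eq_zero fun y _ => ?_
      rw [ind_false (P := 𝒮 A = S), mul_zero]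
      rintro rfl
      exact hoS (Finset.mem_filter.1 hS).2
  by_cases hoS : o ∈ 𝒮 A
  · rw [ind_false (by tauto), zero_add, Finset.sum_eq_single (𝒮 A)]
    · have hsub : bdry nbr (𝒮 A) ⊆ Λ := by
        intro y hy
        simp only [bdry, Finset.mem_sdiff, Finset.mem_biUnion] at hy
        obtain ⟨⟨x, hx, hxy⟩, _⟩ := hy
        have hx' := Finset.mem_filter.1 hx
        exact hΛ x hx'.1 hx'.2.1 hxy
      refine le_trans ?_ (Finset.sum_le_sum_of_subset_of_nonneg hsub fun y _ _ => hterm y)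
      refine Finset.sum_le_sum fun y hy => ?_
      by_cases hQ : QQ nbr o (𝒮 A) y A
      swap
      · rw [ind_false hQ, zero_mul]; exact hterm y
      obtain ⟨x, hx, hxy⟩ := hQ
      have hxS : x ∈ 𝒮 A := by
        have := hx.mem
        simp only [Finset.coe_inter, Set.mem_inter_iff, Finset.mem_coe] at this
        exact this.2
      have hx' := (Finset.mem_filter.1 hxS).2
      have hyΛ := hsub hy
      have hyS : y ∉ 𝒮 A := (Finset.mem_sdiff.1 hy).2
      have hyR : ¬ Reach nbr A T y := fun h => hx'.2.2 y h (hs _ _ hxy)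
      have hy' : y ∈ T ∨ ∃ z, Reach nbr A T z ∧ y ∈ nbr z := by
        by_contra hcon
        push Not at hcon
        exact hyS (Finset.mem_filter.2 ⟨hyΛ, hcon.1, hyR, fun z hz => hcon.2 z hz⟩)
      have hyA : y ∉ A := by
        intro hyA
        rcases hy' with h | ⟨z, hz, h⟩
        · exact hyR (.base h hyA)
        · exact hyR (.step hz h hyA)
      have hAi : (A : Set V) ⊆ ↑(insert y A) := by exact_mod_cast Finset.subset_insert _ _
      have hyI : Reach nbr ↑(insert y A) T y := by
        have hm : y ∈ (↑(insert y A) : Set V) := by simp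
        rcases hy' with h | ⟨z, hz, h⟩
        · exact .base h hm
        · exact .step (hz.mono hAi) h hm
      have hxA : Reach nbr ↑(insert y A) {o} x := by
        refine hx.mono (Set.Subset.trans ?_ hAi)
        exact_mod_cast Finset.inter_subset_left
      have hxo := hxA.symm hs
      have hoI : Reach nbr ↑(insert y A) T o :=
        (Reach.step hyI (hs _ _ hxy) hxA.mem).trans hxo
      rw [ind_true hyA, ind_true hoI, ind_false hR, ind_true rfl]
      have := ind_le_one (QQ nbr o (𝒮 A) y A)
      linarith
    · intro S _ hne
      refine Finset.sum_eq_zero fun y _ => ?_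
      rw [ind_false (P := 𝒮 A = S) (Ne.symm hne), mul_zero]
    · intro h; exact absurd (by simp [hF, hoS, h𝒮Λ]) h
  · rw [ind_true ⟨hR, hoS⟩, Finset.sum_eq_zero]
    · have hy' : o ∈ T ∨ ∃ z, Reach nbr A T z ∧ o ∈ nbr z := by
        by_contra hcon
        push Not at hcon
        exact hoS (Finset.mem_filter.2 ⟨ho, hcon.1, hR, fun z hz => hcon.2 z hz⟩)
      have hyA : o ∉ A := by
        intro hyA
        rcases hy' with h | ⟨z, hz, h⟩
        · exact hR (.base h hyA)
        · exact hR (.step hz h hyA)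
      have hAi : (A : Set V) ⊆ ↑(insert o A) := by exact_mod_cast Finset.subset_insert _ _
      have hyI : Reach nbr ↑(insert o A) T o := by
        have hm : o ∈ (↑(insert o A) : Set V) := by simp
        rcases hy' with h | ⟨z, hz, h⟩
        · exact .base h hm
        · exact .step (hz.mono hAi) h hm
      refine le_trans ?_ (Finset.single_le_sum (fun y _ => hterm y) ho)
      rw [ind_true hyA, ind_true hyI, ind_false hR]
      norm_num
    · intro S hS
      refine Finset.sum_eq_zero fun y _ => ?_
      rw [ind_false (P := 𝒮 A = S), mul_zero]
      rintro rfl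
      exact hoS (Finset.mem_filter.1 hS).2

/-- Integrated differential inequality. -/
lemma dct_lower (hs : ∀ x y, y ∈ nbr x → x ∈ nbr y) {Λ T : Finset V} {o : V} (ho : o ∈ Λ)
    (hΛ : ∀ x ∈ Λ, x ∉ T → nbr x ⊆ Λ) {p q : ℝ} (hp : 0 ≤ p) (hpq : p ≤ q) (hq : q ≤ 1)
    (hφ : ∀ S : Finset V, o ∈ S → 1 ≤ phi nbr o p S) :
    1 - Real.exp (-(q - p)) ≤ EE q Λ (fun A => ind (Reach nbr A T o)) := by
  set f : Finset V → ℝ := fun A => ind (Reach nbr A T o) with hf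
  have hder : ∀ t, HasDerivAt (fun t => (1 - EE t Λ f) * Real.exp t)
      ((1 - EE t Λ f) * Real.exp t - (∑ x ∈ Λ, EE t Λ (fun A => f (insert x A) - f (A.erase x)))
        * Real.exp t) t := by
    intro t
    refine (((EE_russo t Λ f).const_sub 1).mul (Real.hasDerivAt_exp t)).congr_deriv ?_
    ring
  have hanti : AntitoneOn (fun t => (1 - EE t Λ f) * Real.exp t) (Set.Icc p q) := by
    refine antitoneOn_of_deriv_nonpos (convex_Icc p q)
      (fun t _ => (hder t).continuousAt.continuousWithinAt)
      (fun t _ => (hder t).differentiableAt.differentiableWithinAt) ?_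
    intro t ht
    rw [interior_Icc] at ht
    rw [(hder t).deriv]
    have ht0 : 0 ≤ t := by linarith [ht.1]
    have ht1 : t < 1 := by linarith [ht.2]
    have h1 := dct_ineq (T := T) hs ho hΛ (p := t) ⟨ht0, ht1.le⟩
      (fun S hS => (hφ S hS).trans (phi_mono hp ht.1.le ht1.le))
    have h2 : ∑ y ∈ Λ, EE t Λ (fun A => ind (y ∉ A) *
        (ind (Reach nbr ↑(insert y A) T o) - ind (Reach nbr A T o))) =
        (1 - t) * ∑ x ∈ Λ, EE t Λ (fun A => f (insert x A) - f (A.erase x)) := by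
      rw [Finset.mul_sum]
      exact Finset.sum_congr rfl fun x hx => (EE_pivotal t hx f).symm
    rw [h2] at h1
    have h3 : 0 ≤ ∑ x ∈ Λ, EE t Λ (fun A => f (insert x A) - f (A.erase x)) := by
      refine Finset.sum_nonneg fun x _ => EE_nonneg ⟨ht0, ht1.le⟩ fun A _ => ?_
      refine sub_nonneg.2 (ind_mono fun h => h.mono ?_)
      exact_mod_cast (Finset.erase_subset _ _).trans (Finset.subset_insert _ _)
    have h4 : 1 - EE t Λ f ≤ ∑ x ∈ Λ, EE t Λ (fun A => f (insert x A) - f (A.erase x)) := by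
      have : (1 - t) * ∑ x ∈ Λ, EE t Λ (fun A => f (insert x A) - f (A.erase x)) ≤
        ∑ x ∈ Λ, EE t Λ (fun A => f (insert x A) - f (A.erase x)) := by nlinarith
      exact h1.trans this
    have := Real.exp_pos t
    nlinarith
  have h := hanti ⟨le_rfl, hpq⟩ ⟨hpq, le_rfl⟩ hpq
  simp only at h
  have h0 : 0 ≤ EE p Λ f := EE_nonneg ⟨hp, hpq.trans hq⟩ fun _ _ => ind_nonneg _
  have h5 : (1 - EE q Λ f) * Real.exp q ≤ Real.exp p := by
    have := Real.exp_pos p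
    nlinarith
  have h6 : Real.exp (-(q - p)) * Real.exp q = Real.exp p := by
    rw [← Real.exp_add]; ring_nf
  have h7 : 1 - EE q Λ f ≤ Real.exp (-(q - p)) := by
    rw [← h6] at h5
    exact le_of_mul_le_mul_right h5 (Real.exp_pos q)
  linarith

open Classical in
/-- Cluster of `o` in `A ∩ S`. -/
noncomputable def clus (nbr : V → Finset V) (o : V) (S A : Finset V) : Finset V :=
  S.filter fun x => Reach nbr ↑(A ∩ S) {o} x

/-- Explored region when the cluster is `C`. -/
def expl (nbr : V → Finset V) (o : V) (S C : Finset V) : Finset V :=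
  insert o (C ∪ (C.biUnion nbr ∩ S))

lemma mem_clus {o : V} {S A : Finset V} {x : V} :
    x ∈ clus nbr o S A ↔ Reach nbr ↑(A ∩ S) {o} x := by
  classical
  unfold clus
  rw [Finset.mem_filter]
  refine ⟨fun h => h.2, fun h => ⟨?_, h⟩⟩
  have := h.mem
  simp only [Finset.coe_inter, Set.mem_inter_iff, Finset.mem_coe] at this
  exact this.2

lemma clus_indep {o : V} {S C A : Finset V} :
    clus nbr o S A = C ↔ clus nbr o S (A ∩ expl nbr o S C) = C := by
  have key : ∀ A A' : Finset V, clus nbr o S A = C →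
      (∀ x, x ∈ expl nbr o S C → (x ∈ A ↔ x ∈ A')) → clus nbr o S A' = C := by
    intro A A' h hAA
    rw [← h]
    ext x
    rw [mem_clus, mem_clus]
    refine (Reach.explore ?_ x).symm
    intro x hx
    simp only [Finset.coe_inter, Set.mem_inter_iff, Finset.mem_coe]
    refine and_congr_left fun hxS => hAA x ?_
    unfold expl
    rcases hx with hx | hx | ⟨z, hz, hx⟩
    · rw [Set.mem_singleton_iff.1 hx]; exact Finset.mem_insert_self _ _
    · rw [← mem_clus, h] at hx
      simp [hx]
    · rw [← mem_clus, h] at hz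
      refine Finset.mem_insert_of_mem (Finset.mem_union_right _ (Finset.mem_inter.2 ⟨?_, hxS⟩))
      exact Finset.mem_biUnion.2 ⟨z, hz, hx⟩
  constructor
  · intro h
    exact key _ _ h (fun x hx => by simp [hx])
  · intro h
    exact key _ _ h (fun x hx => by simp [hx])

/-- Simon–Lieb type inequality.  `far y z` is the event that `z` is a far target. -/
lemma simon_lieb {Λ S : Finset V} {o : V} (hoS : o ∈ S) (hSΛ : S ⊆ Λ)
    {p : ℝ} (hp : p ∈ Set.Icc (0:ℝ) 1) (far : V → V → Prop) (far' : V → Prop)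
    (h1 : ∀ x ∈ S, ¬ far' x) (h2 : ∀ y ∈ bdry nbr S, ∀ z, far' z → far y z) :
    EE p Λ (fun A => ind (∃ z, Reach nbr A {o} z ∧ far' z)) ≤
      ∑ y ∈ bdry nbr S, EE p S (fun A => ind (QQ nbr o S y A)) *
        EE p Λ (fun A => ind (∃ z, Reach nbr A {y} z ∧ far y z)) := by
  classical
  have hpt : ∀ A, A ⊆ Λ → ind (∃ z, Reach nbr A {o} z ∧ far' z) ≤
      ∑ y ∈ bdry nbr S, ∑ C ∈ S.powerset.filter (fun C => y ∈ C.biUnion nbr),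
        ind (clus nbr o S A = C) *
          ind (∃ z, Reach nbr ↑(A \ expl nbr o S C) {y} z ∧ far y z) := by
    intro A hA
    by_cases hE : ∃ z, Reach nbr A {o} z ∧ far' z
    swap
    · rw [ind_false hE]
      exact Finset.sum_nonneg fun y _ => Finset.sum_nonneg fun C _ =>
        mul_nonneg (ind_nonneg _) (ind_nonneg _)
    obtain ⟨z, hz, hfar⟩ := hE
    set C := clus nbr o S A with hC
    have hoA : o ∈ A := by
      exact_mod_cast hz.start_mem
    have main : ∀ z, Reach nbr A {o} z → z ∈ C ∨
        ∃ y ∈ bdry nbr S, y ∈ C.biUnion nbr ∧ Reach nbr ↑(A \ expl nbr o S C) {y} z := by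
      have hoC : o ∈ C := by
        rw [hC, mem_clus]; exact .base rfl (by simp [hoA, hoS])
      have hexpl : ∀ z ∈ A, z ∉ C → z ∉ expl nbr o S C := by
        intro z hzA hzC hze
        simp only [expl, Finset.mem_insert, Finset.mem_union, Finset.mem_inter,
          Finset.mem_biUnion] at hze
        rcases hze with rfl | h | ⟨⟨x, hx, hxz⟩, hzS⟩
        · exact hzC hoC
        · exact hzC h
        · refine hzC ?_
          rw [hC, mem_clus] at hx ⊢
          exact .step hx hxz (by simp [hzA, hzS])
      intro z hz
      induction hz with
      | base h _ => left; rw [Set.mem_singleton_iff.1 h]; exact hoC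
      | @step y z hy hyz hzA ih =>
        by_cases hzC : z ∈ C
        · exact Or.inl hzC
        right
        have hzA' : z ∈ A := by exact_mod_cast hzA
        have hzm : z ∈ (↑(A \ expl nbr o S C) : Set V) := by
          have := hexpl z hzA' hzC
          simp [hzA', this]
        rcases ih with hyC | ⟨w, hw, hwC, hwy⟩
        · refine ⟨z, ?_, Finset.mem_biUnion.2 ⟨y, hyC, hyz⟩, .base rfl hzm⟩
          have hyC' := hyC
          rw [hC, mem_clus] at hyC'
          have hyS := hyC'.mem
          simp only [Finset.coe_inter, Set.mem_inter_iff, Finset.mem_coe] at hyS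
          refine Finset.mem_sdiff.2 ⟨Finset.mem_biUnion.2 ⟨y, hyS.2, hyz⟩, fun hzS => hzC ?_⟩
          rw [hC, mem_clus]
          exact .step hyC' hyz (by simp [hzA', hzS])
        · exact ⟨w, hw, hwC, .step hwy hyz hzm⟩
    rcases main z hz with hzC | ⟨y, hy, hyC, hyz⟩
    · exact absurd hfar (h1 z (Finset.filter_subset _ _ hzC))
    · rw [ind_true ⟨z, hz, hfar⟩]
      refine le_trans ?_ (Finset.single_le_sum (fun y _ => Finset.sum_nonneg fun C _ =>
        mul_nonneg (ind_nonneg _) (ind_nonneg _)) hy)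
      refine le_trans ?_ (Finset.single_le_sum (a := C) (fun C _ =>
        mul_nonneg (ind_nonneg _) (ind_nonneg _)) ?_)
      · rw [ind_true rfl, ind_true ⟨z, hyz, h2 y hy z hfar⟩, one_mul]
      · rw [Finset.mem_filter]
        exact ⟨Finset.mem_powerset.2 (Finset.filter_subset _ _), hyC⟩
  refine (EE_mono hp hpt).trans ?_
  rw [EE_sum]
  refine Finset.sum_le_sum fun y hy => ?_
  rw [EE_sum]
  have hb : ∀ C ∈ S.powerset.filter (fun C => y ∈ C.biUnion nbr),
      EE p Λ (fun A => ind (clus nbr o S A = C) *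
          ind (∃ z, Reach nbr ↑(A \ expl nbr o S C) {y} z ∧ far y z)) ≤
      EE p Λ (fun A => ind (clus nbr o S A = C)) *
        EE p Λ (fun A => ind (∃ z, Reach nbr A {y} z ∧ far y z)) := by
    intro C hCm
    have hCS : C ⊆ S := Finset.mem_powerset.1 (Finset.mem_filter.1 hCm).1
    have hXΛ : expl nbr o S C ⊆ Λ := by
      refine Finset.Subset.trans ?_ hSΛ
      refine Finset.insert_subset hoS (Finset.union_subset hCS Finset.inter_subset_right)
    rw [EE_indep p hXΛ (fun A => ind (clus nbr o S A = C))
      (fun A => ind (∃ z, Reach nbr ↑(A \ expl nbr o S C) {y} z ∧ far y z))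
      (fun A _ => ind_congr clus_indep)
      (fun A _ => by simp only [Finset.sdiff_idem]),
      ← EE_restrict p hXΛ _ (fun A _ => ind_congr clus_indep)]
    refine mul_le_mul_of_nonneg_left ?_ (EE_nonneg hp fun _ _ => ind_nonneg _)
    refine EE_mono hp fun A _ => ind_mono ?_
    rintro ⟨z, hz, hf⟩
    exact ⟨z, hz.mono (by exact_mod_cast Finset.sdiff_subset), hf⟩
  refine (Finset.sum_le_sum hb).trans ?_
  rw [← Finset.sum_mul, ← EE_sum]
  refine mul_le_mul_of_nonneg_right ?_ (EE_nonneg hp fun _ _ => ind_nonneg _)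
  rw [← EE_restrict p hSΛ (fun A => ind (QQ nbr o S y A))
    (fun A _ => by unfold QQ; rw [Finset.inter_assoc, Finset.inter_self])]
  refine EE_mono hp fun A _ => ?_
  by_cases hQ : y ∈ (clus nbr o S A).biUnion nbr
  · rw [ind_true (P := QQ nbr o S y A), Finset.sum_eq_single (clus nbr o S A), ind_true rfl]
    · intro C _ hne; exact ind_false (Ne.symm hne)
    · intro h
      exact absurd (Finset.mem_filter.2
        ⟨Finset.mem_powerset.2 (Finset.filter_subset _ _), hQ⟩) h
    · obtain ⟨x, hx, hxy⟩ := Finset.mem_biUnion.1 hQ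
      exact ⟨x, mem_clus.1 hx, hxy⟩
  · rw [Finset.sum_eq_zero]
    · exact ind_nonneg _
    · intro C hCm
      refine ind_false ?_
      rintro rfl
      exact hQ (Finset.mem_filter.1 hCm).2

end Graph

/-! ### The lattice -/

section Lattice

variable {d : ℕ}

lemma dinf_le_iff {x y : Site d} {n : ℕ} : dinf x y ≤ n ↔ ∀ i, (x i - y i).natAbs ≤ n := by
  simp [dinf, Finset.sup_le_iff]

lemma le_dinf (x y : Site d) (i : Fin d) : (x i - y i).natAbs ≤ dinf x y :=
  dinf_le_iff.1 le_rfl i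

lemma dinf_triangle (x y z : Site d) : dinf x z ≤ dinf x y + dinf y z := by
  rw [dinf_le_iff]
  intro i
  have h1 := le_dinf x y i
  have h2 := le_dinf y z i
  omega

lemma dinf_comm (x y : Site d) : dinf x y = dinf y x := by
  unfold dinf
  refine Finset.sup_congr rfl fun i _ => ?_
  omega

lemma dinf_self (x : Site d) : dinf x x = 0 := by
  have : dinf x x ≤ 0 := dinf_le_iff.2 (by simp)
  omega

lemma dinf_le_d1 (x y : Site d) : dinf x y ≤ d1 x y := by
  rw [dinf_le_iff]
  intro i
  exact Finset.single_le_sum (f := fun i => (x i - y i).natAbs) (fun _ _ => Nat.zero_le _)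
    (Finset.mem_univ i)

lemma d1_comm (x y : Site d) : d1 x y = d1 y x := by
  unfold d1
  refine Finset.sum_congr rfl fun i _ => ?_
  omega

/-- Lattice neighbours. -/
noncomputable def nb (x : Site d) : Finset (Site d) :=
  (Fintype.piFinset fun i => Finset.Icc (x i - 1) (x i + 1)).filter fun y => d1 x y = 1

lemma mem_nb {x y : Site d} : y ∈ nb x ↔ d1 x y = 1 := by
  unfold nb
  rw [Finset.mem_filter, Fintype.mem_piFinset]
  refine ⟨fun h => h.2, fun h => ⟨fun i => ?_, h⟩⟩
  have h1 := le_dinf x y i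
  have h2 := dinf_le_d1 x y
  rw [Finset.mem_Icc]
  omega

lemma nb_symm (x y : Site d) (h : y ∈ nb x) : x ∈ nb y := by
  rw [mem_nb] at h ⊢
  rw [d1_comm, h]

/-- The box of radius `n`. -/
noncomputable def box (d n : ℕ) : Finset (Site d) := Fintype.piFinset fun _ => Finset.Icc (-(n : ℤ)) n

lemma mem_box {n : ℕ} {x : Site d} : x ∈ box d n ↔ dinf x 0 ≤ n := by
  unfold box
  rw [Fintype.mem_piFinset, dinf_le_iff]
  refine forall_congr' fun i => ?_
  rw [Finset.mem_Icc, Pi.zero_apply]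
  omega

/-- The sphere of radius `n`. -/
noncomputable def sph (d n : ℕ) : Finset (Site d) := (box d n).filter fun x => dinf x 0 = n

lemma nb_box {n : ℕ} (x : Site d) (hx : x ∈ box d n) (hx' : x ∉ sph d n) : nb x ⊆ box d n := by
  intro y hy
  have h1 : dinf x 0 ≠ n := fun h => hx' (Finset.mem_filter.2 ⟨hx, h⟩)
  rw [mem_box] at hx ⊢
  have h2 := dinf_triangle y x 0
  have h3 := dinf_le_d1 y x
  rw [d1_comm, mem_nb.1 hy] at h3
  omega

/-- The arm event. -/
def Arm (d n : ℕ) (ω : Set (Site d)) : Prop := ∃ z, Reach nb ω {0} z ∧ n ≤ dinf z 0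

lemma Arm.mono {n m : ℕ} {ω ω' : Set (Site d)} (hω : ω ⊆ ω') (hn : m ≤ n) (h : Arm d n ω) :
    Arm d m ω' := by
  obtain ⟨z, hz, h⟩ := h
  exact ⟨z, hz.mono hω, hn.trans h⟩

lemma arm_trunc {n : ℕ} {ω : Set (Site d)} (h : Arm d n ω) : Arm d n (ω ∩ ↑(box d n)) := by
  obtain ⟨z, hz, hn⟩ := h
  have : Reach nb (ω ∩ ↑(box d n)) {0} z ∨ Arm d n (ω ∩ ↑(box d n)) := by
    clear hn
    induction hz with
    | @base t h1 h2 =>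
      left
      refine .base h1 ⟨h2, ?_⟩
      rw [Set.mem_singleton_iff.1 h1, Finset.mem_coe, mem_box, dinf_self]
      exact Nat.zero_le _
    | @step y z _ h2 h3 ih =>
      rcases ih with ih | ih
      · by_cases hy : n ≤ dinf y 0
        · exact Or.inr ⟨y, ih, hy⟩
        · left
          refine .step ih h2 ⟨h3, ?_⟩
          rw [Finset.mem_coe, mem_box]
          have h5 := dinf_triangle z y 0
          have h6 := dinf_le_d1 z y
          rw [d1_comm, mem_nb.1 h2] at h6
          omega
      · exact Or.inr ih
  rcases this with h | h
  · exact ⟨z, h, hn⟩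
  · exact h

lemma Reach.translate {ω ω' : Set (Site d)} {y z : Site d} (v : Site d)
    (hω : ∀ x ∈ ω, x - v ∈ ω') (h : Reach nb ω {y} z) : Reach nb ω' {y - v} (z - v) := by
  induction h with
  | base h h' =>
    rw [Set.mem_singleton_iff.1 h] at h' ⊢
    exact .base rfl (hω _ h')
  | step _ h2 h3 ih =>
    refine .step ih ?_ (hω _ h3)
    rw [mem_nb] at h2 ⊢
    rw [← h2]
    simp [d1]

lemma EE_arm_translate {p : ℝ} (hp : p ∈ Set.Icc (0:ℝ) 1) (Λ : Finset (Site d)) (y : Site d)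
    (n : ℕ) : EE p Λ (fun A => ind (∃ z, Reach nb A {y} z ∧ n ≤ dinf z y)) ≤
      EE p (Λ.map (Equiv.subRight y).toEmbedding) (fun A => ind (Arm d n A)) := by
  rw [EE_map]
  refine EE_mono hp fun A _ => ind_mono ?_
  rintro ⟨z, hz, hn⟩
  refine ⟨z - y, ?_, ?_⟩
  · have := hz.translate (ω' := ↑(A.map (Equiv.subRight y).toEmbedding)) y ?_
    · simpa using this
    · intro x hx
      simpa using hx
  · have : dinf (z - y) 0 = dinf z y := by simp [dinf]
    omega

lemma EE_arm_mono {p : ℝ} (hp : p ∈ Set.Icc (0:ℝ) 1) {Λ Λ' : Finset (Site d)} (h : Λ ⊆ Λ')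
    {n m : ℕ} (hnm : m ≤ n) :
    EE p Λ (fun A => ind (Arm d n A)) ≤ EE p Λ' (fun A => ind (Arm d m A)) := by
  have h1 : EE p Λ' (fun A => ind (Arm d n ↑(A ∩ Λ))) = EE p Λ (fun A => ind (Arm d n ↑(A ∩ Λ))) :=
    EE_restrict p h _ (fun A _ => by rw [Finset.inter_assoc, Finset.inter_self])
  have h2 : EE p Λ (fun A => ind (Arm d n ↑(A ∩ Λ))) = EE p Λ (fun A => ind (Arm d n A)) :=
    EE_congr fun A hA => by rw [Finset.inter_eq_left.2 hA]
  rw [← h2, ← h1]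
  refine EE_mono hp fun A _ => ind_mono (Arm.mono ?_ hnm)
  exact_mod_cast Finset.inter_subset_left

lemma arm_decay {p : ℝ} (hp : p ∈ Set.Icc (0:ℝ) 1) {S : Finset (Site d)} (hS : 0 ∈ S) {R : ℕ}
    (hR1 : ∀ x ∈ S, dinf x 0 < R) (hR2 : ∀ x ∈ bdry nb S, dinf x 0 ≤ R) (k : ℕ)
    (Λ : Finset (Site d)) :
    EE p Λ (fun A => ind (Arm d (k * R) A)) ≤ phi nb 0 p S ^ k := by
  induction k generalizing Λ with
  | zero =>
    rw [pow_zero]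
    exact (EE_mono hp fun A _ => ind_le_one _).trans (EE_const p Λ 1).le
  | succ k ih =>
    refine (EE_arm_mono hp (Finset.subset_union_left (s₂ := S)) le_rfl).trans ?_
    refine (simon_lieb hS Finset.subset_union_right hp (fun y z => k * R ≤ dinf z y)
      (fun z => (k + 1) * R ≤ dinf z 0) ?_ ?_).trans ?_
    · intro x hx h
      have := hR1 x hx
      nlinarith
    · intro y hy z hz
      have h1 := hR2 y hy
      have h2 := dinf_triangle z y 0
      nlinarith
    · rw [pow_succ', phi, Finset.sum_mul]
      refine Finset.sum_le_sum fun y _ => ?_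
      refine mul_le_mul_of_nonneg_left ?_ (EE_nonneg hp fun _ _ => ind_nonneg _)
      exact (EE_arm_translate hp _ y _).trans (ih _)

/-! ### Bridge to the measures -/

/-- The open sites of `ξ` in `Λ`. -/
noncomputable def opn (Λ : Finset (Site d)) (ξ : Config d) : Finset (Site d) := Λ.filter fun x => ξ x = true

lemma coe_opn (Λ : Finset (Site d)) (ξ : Config d) :
    (↑(opn Λ ξ) : Set (Site d)) = {x | ξ x = true} ∩ ↑Λ := by
  ext x; simp [opn, and_comm]

lemma opn_eq_iff {Λ A : Finset (Site d)} (hA : A ⊆ Λ) (ξ : Config d) :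
    opn Λ ξ = A ↔ ∀ x ∈ Λ, ξ x = decide (x ∈ A) := by
  constructor
  · rintro rfl x hx
    simp [opn, hx]
  · intro h
    ext x
    simp only [opn, Finset.mem_filter]
    constructor
    · rintro ⟨h1, h2⟩
      rw [h x h1] at h2
      simpa using h2
    · intro hx
      exact ⟨hA hx, by rw [h x (hA hx)]; simpa using hx⟩

lemma measurable_opn (Λ A : Finset (Site d)) (hA : A ⊆ Λ) :
    MeasurableSet {ξ : Config d | opn Λ ξ = A} := by
  simp only [opn_eq_iff hA]
  have : {ξ : Config d | ∀ x ∈ Λ, ξ x = decide (x ∈ A)} =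
      ⋂ x ∈ Λ, (fun ξ : Config d => ξ x) ⁻¹' {decide (x ∈ A)} := by
    ext ξ; simp
  rw [this]
  exact Finset.measurableSet_biInter _ fun x _ => measurable_pi_apply x (measurableSet_singleton _)

lemma event_eq (Λ : Finset (Site d)) (E : Finset (Site d) → Prop) [DecidablePred E] :
    {ξ : Config d | E (opn Λ ξ)} =
      ⋃ A ∈ Λ.powerset.filter E, {ξ : Config d | opn Λ ξ = A} := by
  ext ξ
  simp only [Set.mem_ofPred_eq, Finset.mem_filter, Finset.mem_powerset, Set.mem_iUnion, exists_prop]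
  constructor
  · intro h
    exact ⟨_, ⟨Finset.filter_subset _ _, h⟩, rfl⟩
  · rintro ⟨A, ⟨_, h⟩, rfl⟩
    exact h

lemma measurable_event (Λ : Finset (Site d)) (E : Finset (Site d) → Prop) :
    MeasurableSet {ξ : Config d | E (opn Λ ξ)} := by
  classical
  rw [event_eq]
  refine Finset.measurableSet_biUnion _ fun A hA => measurable_opn Λ A ?_
  exact Finset.mem_powerset.1 (Finset.mem_filter.1 hA).1

lemma measure_event {p : ℝ} (hp : p ∈ Set.Icc (0:ℝ) 1) {μ : Measure (Config d)}
    (hμ : IsBernoulliProduct d p μ) (Λ : Finset (Site d)) (E : Finset (Site d) → Prop) :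
    μ {ξ : Config d | E (opn Λ ξ)} = ENNReal.ofReal (EE p Λ (fun A => ind (E A))) := by
  classical
  have hp1 : 0 ≤ 1 - p := by linarith [hp.2]
  rw [event_eq, measure_biUnion_finset]
  · have hc : ∀ A ∈ Λ.powerset.filter E, μ {ξ : Config d | opn Λ ξ = A} =
        ENNReal.ofReal (p ^ A.card * (1 - p) ^ (Λ \ A).card) := by
      intro A hA
      have hA' := Finset.mem_powerset.1 (Finset.mem_filter.1 hA).1
      simp only [opn_eq_iff hA']
      rw [hμ.2 Λ (fun x => decide (x ∈ A)), ← ENNReal.ofReal_prod_of_nonneg]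
      · congr 1
        simp only [decide_eq_true_eq]
        rw [Finset.prod_ite, Finset.prod_const, Finset.prod_const, Finset.filter_mem_eq_inter,
          Finset.inter_eq_right.2 hA', Finset.filter_notMem_eq_sdiff]
      · intro x _
        split_ifs
        · exact hp.1
        · exact hp1
    rw [Finset.sum_congr rfl hc, ← ENNReal.ofReal_sum_of_nonneg]
    · congr 1
      unfold EE
      rw [Finset.sum_filter]
      refine Finset.sum_congr rfl fun A _ => ?_
      by_cases h : E A <;> simp [ind, h]
    · intro A _
      exact mul_nonneg (pow_nonneg hp.1 _) (pow_nonneg hp1 _)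
  · intro A _ B _ hAB
    refine Set.disjoint_left.2 ?_
    rintro ξ rfl h
    exact hAB h
  · intro A hA
    exact measurable_opn Λ A (Finset.mem_powerset.1 (Finset.mem_filter.1 hA).1)

/-! ### Infinite paths -/

/-- Self-avoiding open paths of length `n` from the origin, frozen after time `n`. -/
def SAP (ξ : Config d) (n : ℕ) : Type :=
  {γ : ℕ → Site d // γ 0 = 0 ∧ Set.InjOn γ (Set.Iic n) ∧ (∀ i < n, d1 (γ i) (γ (i + 1)) = 1) ∧
    (∀ i ≤ n, ξ (γ i) = true) ∧ ∀ i, n ≤ i → γ i = γ n}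

/-- Truncation of a self-avoiding path. -/
def SAP.proj {ξ : Config d} {i j : ℕ} (hij : i ≤ j) (γ : SAP ξ j) : SAP ξ i :=
  ⟨fun k => γ.1 (min k i), by
    obtain ⟨γ, h0, h1, h2, h3, h4⟩ := γ
    refine ⟨by simpa using h0, ?_, ?_, ?_, ?_⟩
    · intro a ha b hb hab
      simp only [Set.mem_Iic] at ha hb
      simp only [min_eq_left ha, min_eq_left hb] at hab
      exact h1 (ha.trans hij) (hb.trans hij) hab
    · intro k hk
      simp only [min_eq_left hk.le, min_eq_left (Nat.succ_le_of_lt hk)]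
      exact h2 k (by omega)
    · intro k hk
      exact h3 _ ((min_le_right _ _).trans hij)
    · intro k hk
      simp [hk]⟩

lemma exists_ray (ξ : Config d) (h : ∀ n, Nonempty (SAP ξ n)) : ξ ∈ Perc d := by
  have hfin0 : Finite (SAP ξ 0) := by
    have : Subsingleton (SAP ξ 0) := by
      refine ⟨fun a b => Subtype.ext (funext fun i => ?_)⟩
      rw [a.2.2.2.2.2 i (Nat.zero_le _), b.2.2.2.2.2 i (Nat.zero_le _), a.2.1, b.2.1]
    infer_instance
  obtain ⟨f, hf⟩ := exists_seq_forall_proj_of_forall_finite (α := SAP ξ)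
    (fun {i j} hij γ => SAP.proj hij γ)
    (by
      intro i γ
      refine Subtype.ext (funext fun k => ?_)
      change γ.1 (min k i) = γ.1 k
      rcases le_total k i with h | h
      · rw [min_eq_left h]
      · rw [min_eq_right h, γ.2.2.2.2.2 k h])
    (by
      intro i j k hij hjk γ
      refine Subtype.ext (funext fun m => ?_)
      change γ.1 (min (min m i) j) = γ.1 (min m i)
      rw [min_eq_left ((min_le_right _ _).trans hij)])
    (by
      intro i a
      refine Set.Finite.of_finite_image (f := fun b : SAP ξ (i + 1) => b.1 (i + 1)) ?_ ?_
      · refine (nb (a.1 i)).finite_toSet.subset ?_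
        rintro _ ⟨b, hb, rfl⟩
        have hb' : SAP.proj (Nat.le_add_right i 1) b = a := hb
        rw [Finset.mem_coe, mem_nb, ← hb']
        change d1 (b.1 (min i i)) (b.1 (i + 1)) = 1
        rw [min_self]
        exact b.2.2.2.1 i (Nat.lt_succ_self i)
      · intro b hb c hc hbc
        have hb' : SAP.proj (Nat.le_add_right i 1) b = a := hb
        have hc' : SAP.proj (Nat.le_add_right i 1) c = a := hc
        refine Subtype.ext (funext fun k => ?_)
        rcases Nat.lt_or_ge i k with hk | hk
        · rw [b.2.2.2.2.2 k hk, c.2.2.2.2.2 k hk]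
          exact hbc
        · have h1 := congrArg (fun s : SAP ξ i => s.1 k) (hb'.trans hc'.symm)
          change b.1 (min k i) = c.1 (min k i) at h1
          rwa [min_eq_left hk] at h1)
  have hval : ∀ i j, i ≤ j → (f j).1 i = (f i).1 i := by
    intro i j hij
    have h1 := congrArg (fun s : SAP ξ i => s.1 i) (hf hij)
    change (f j).1 (min i i) = (f i).1 i at h1
    rwa [min_self] at h1
  refine ⟨fun n => (f n).1 n, ?_, ?_, ?_⟩
  · intro a b hab
    simp only at hab
    rw [← hval a (max a b) (le_max_left _ _), ← hval b (max a b) (le_max_right _ _)] at hab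
    exact (f (max a b)).2.2.1 (le_max_left a b) (le_max_right a b) hab
  · intro n
    simp only
    rw [← hval n (n + 1) (Nat.le_succ n)]
    exact (f (n + 1)).2.2.2.1 n (Nat.lt_succ_self n)
  · intro n
    exact (f n).2.2.2.2.1 n le_rfl

/-- The graph of open sites. -/
def openGraph (ξ : Config d) : SimpleGraph (Site d) where
  Adj x y := d1 x y = 1 ∧ ξ x = true ∧ ξ y = true
  symm := ⟨fun x y h => ⟨by rw [d1_comm]; exact h.1, h.2.2, h.2.1⟩⟩
  loopless := ⟨fun x h => by simp [d1] at h⟩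

lemma reachable_of_reach {ξ : Config d} {z : Site d} (h : Reach nb {x | ξ x = true} {0} z) :
    (openGraph ξ).Reachable 0 z := by
  induction h with
  | base h _ => rw [Set.mem_singleton_iff.1 h]
  | @step y z h1 h2 h3 ih =>
    have : (openGraph ξ).Adj y z := ⟨mem_nb.1 h2, h1.mem, h3⟩
    exact ih.trans this.reachable

lemma dinf_le_length {ξ : Config d} {x z : Site d} (w : (openGraph ξ).Walk x z) :
    dinf z x ≤ w.length := by
  induction w with
  | nil => rw [dinf_self]; exact Nat.zero_le _
  | @cons u v w h p ih =>
    rw [SimpleGraph.Walk.length_cons]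
    have h1 := dinf_triangle w v u
    have h2 := dinf_le_d1 v u
    rw [d1_comm, h.1] at h2
    omega

lemma sap_of_arm {ξ : Config d} {n : ℕ} (h : Arm d n {x | ξ x = true}) : Nonempty (SAP ξ n) := by
  obtain ⟨z, hz, hn⟩ := h
  have h0 : ξ 0 = true := hz.start_mem
  obtain ⟨w, hw⟩ := (reachable_of_reach hz).exists_isPath
  have hlen : n ≤ w.length := hn.trans (dinf_le_length w)
  have hadj : ∀ i < n, (openGraph ξ).Adj (w.getVert i) (w.getVert (i + 1)) := fun i hi =>
    w.adj_getVert_succ (by omega)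
  refine ⟨⟨fun k => w.getVert (min k n), by simp, ?_, ?_, ?_, ?_⟩⟩
  · intro a ha b hb hab
    simp only [Set.mem_Iic] at ha hb
    simp only [min_eq_left ha, min_eq_left hb] at hab
    exact hw.getVert_injOn (ha.trans hlen) (hb.trans hlen) hab
  · intro k hk
    simp only [min_eq_left hk.le, min_eq_left (Nat.succ_le_of_lt hk)]
    exact (hadj k hk).1
  · intro k hk
    simp only [min_eq_left hk]
    rcases Nat.eq_zero_or_pos k with rfl | hk0
    · simpa using h0
    · obtain ⟨m, rfl⟩ := Nat.exists_eq_succ_of_ne_zero hk0.ne'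
      exact (hadj m hk).2.2
  · intro k hk
    simp [hk]

/-! ### Assembly -/

lemma arm_opn_iff (ξ : Config d) (n : ℕ) :
    Arm d n {x | ξ x = true} ↔ Arm d n ↑(opn (box d n) ξ) := by
  rw [coe_opn]
  exact ⟨arm_trunc, fun h => h.mono Set.inter_subset_left le_rfl⟩

lemma zero_mem_box (n : ℕ) : (0 : Site d) ∈ box d n := by
  rw [mem_box, dinf_self]; exact Nat.zero_le _

lemma perc_pos {p q : ℝ} (hp : 0 ≤ p) (hpq : p < q) (hq : q ≤ 1) {μ : Measure (Config d)}
    (hμ : IsBernoulliProduct d q μ)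
    (hφ : ∀ S : Finset (Site d), 0 ∈ S → 1 ≤ phi nb 0 p S) : μ (Perc d) ≠ 0 := by
  have hqI : q ∈ Set.Icc (0:ℝ) 1 := ⟨by linarith, hq⟩
  have := hμ.1
  set c := ENNReal.ofReal (1 - Real.exp (-(q - p))) with hc
  have hcpos : 0 < c := by
    rw [hc, ENNReal.ofReal_pos, sub_pos, Real.exp_lt_one_iff]
    linarith
  let D : ℕ → Set (Config d) := fun n => {ξ | Arm d n {x | ξ x = true}}
  have hDeq : ∀ n, D n = {ξ : Config d | Arm d n ↑(opn (box d n) ξ)} := fun n =>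
    Set.ext fun ξ => arm_opn_iff ξ n
  have hDm : ∀ n, MeasurableSet (D n) := by
    intro n
    rw [hDeq]
    exact measurable_event (box d n) (fun A => Arm d n ↑A)
  have hDc : ∀ n, c ≤ μ (D n) := by
    intro n
    rw [hDeq, measure_event hqI hμ (box d n) (fun A => Arm d n ↑A)]
    refine ENNReal.ofReal_le_ofReal ?_
    refine (dct_lower (T := sph d n) nb_symm (zero_mem_box n) nb_box hp hpq.le hq hφ).trans ?_
    refine EE_mono hqI fun A _ => ind_mono fun h => ?_
    obtain ⟨t, ht, h⟩ := h.exists_source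
    refine ⟨t, h.symm nb_symm, ?_⟩
    exact (Finset.mem_filter.1 (by exact_mod_cast ht : t ∈ sph d n)).2.ge
  have hanti : Antitone D := fun m n hmn ξ h => Arm.mono subset_rfl hmn h
  have hlim := tendsto_measure_iInter_atTop (μ := μ) (fun n => (hDm n).nullMeasurableSet) hanti
    ⟨0, measure_ne_top _ _⟩
  have h1 : c ≤ μ (⋂ n, D n) := ge_of_tendsto' hlim hDc
  have h2 : ⋂ n, D n ⊆ Perc d := by
    intro ξ hξ
    rw [Set.mem_iInter] at hξ
    exact exists_ray ξ fun n => sap_of_arm (hξ n)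
  exact (hcpos.trans_le (h1.trans (measure_mono h2))).ne'

lemma EE_arm_le_p {p : ℝ} (hp : p ∈ Set.Icc (0:ℝ) 1) (n m : ℕ) :
    EE p (box d n) (fun A => ind (Arm d m A)) ≤ p := by
  have h1 : EE p (box d n) (fun A => ind (Arm d m A)) ≤
      EE p (box d n) (fun A => ind ((0 : Site d) ∈ A)) := by
    refine EE_mono hp fun A _ => ind_mono ?_
    rintro ⟨z, hz, _⟩
    exact_mod_cast hz.start_mem
  refine h1.trans (le_of_eq ?_)
  rw [EE_restrict p (S := {0}) (by simpa using zero_mem_box n) _ (fun A _ => ind_congr (by simp))]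
  rw [← Finset.insert_empty, EE_insert p (Finset.notMem_empty _)]
  simp [EE, ind]

lemma event_subset (L : ℕ) :
    {ξ : Config d | ∃ (n : ℕ) (γ : ℕ → Site d), γ 0 = 0 ∧ dinf (γ n) 0 = L ∧
          (∀ i < n, d1 (γ i) (γ (i + 1)) = 1) ∧ (∀ i ≤ n, ξ (γ i) = true)} ⊆
      {ξ : Config d | Arm d L ↑(opn (box d L) ξ)} := by
  rintro ξ ⟨n, γ, h0, hL, hstep, hopen⟩
  rw [Set.mem_ofPred_eq, ← arm_opn_iff]
  have : ∀ i ≤ n, Reach nb {x | ξ x = true} {0} (γ i) := by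
    intro i
    induction i with
    | zero => intro h; exact .base h0 (hopen 0 h)
    | succ i ih =>
      intro h
      exact .step (ih (by omega)) (mem_nb.2 (hstep i (by omega))) (hopen _ h)
  exact ⟨γ n, this n le_rfl, hL.ge⟩

end Lattice

/-- Let `π_p`, `p ∈ [0,1]`, be the Bernoulli site-percolation measures
on `{0,1}^{ℤ^d}` and `p_c = sup{p ∈ [0,1] : π_p(Perc) = 0}`. For `p < p_c` there is a
constant `c > 0` such that for every `L ≥ 1`, the `π_p`-probability that the origin is
joined to `∂B(L) = B(L) ∖ B(L−1)` by a nearest-neighbour path of open sites is at most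
`exp(−c·L)`. -/
theorem one_arm_exponential_decay (d : ℕ) (hd : 1 ≤ d)
    (π : ℝ → Measure (Config d))
    (hπ : ∀ p ∈ Set.Icc (0 : ℝ) 1, IsBernoulliProduct d p (π p))
    (p : ℝ) (hp : p ∈ Set.Icc (0 : ℝ) 1)
    (hppc : p < sSup {q : ℝ | q ∈ Set.Icc (0 : ℝ) 1 ∧ π q (Perc d) = 0}) :
    ∃ c : ℝ, 0 < c ∧ ∀ L : ℕ, 1 ≤ L →
      π p {ξ : Config d | ∃ (n : ℕ) (γ : ℕ → Site d), γ 0 = 0 ∧ dinf (γ n) 0 = L ∧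
          (∀ i < n, d1 (γ i) (γ (i + 1)) = 1) ∧ (∀ i ≤ n, ξ (γ i) = true)} ≤
        ENNReal.ofReal (Real.exp (-c * L)) := by
  -- a parameter `q > p` without percolation
  have hne : {q : ℝ | q ∈ Set.Icc (0 : ℝ) 1 ∧ π q (Perc d) = 0}.Nonempty := by
    by_contra h
    rw [Set.not_nonempty_iff_eq_empty] at h
    rw [h, Real.sSup_empty] at hppc
    exact absurd hp.1 (not_le.2 hppc)
  obtain ⟨q, ⟨hqI, hq0⟩, hpq⟩ := exists_lt_of_lt_csSup hne hppc
  -- a finite set with `φ_p(S) < 1`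
  obtain ⟨S, hS, hφ⟩ : ∃ S : Finset (Site d), 0 ∈ S ∧ phi nb 0 p S < 1 := by
    by_contra hcon
    push Not at hcon
    exact perc_pos hp.1 hpq hqI.2 (hπ q hqI) hcon hq0
  have hp1 : p < 1 := hpq.trans_le hqI.2
  set R : ℕ := (S ∪ bdry nb S).sup (fun x => dinf x 0) + 1 with hR
  have hRle : ∀ x ∈ S ∪ bdry nb S, dinf x 0 < R := fun x hx =>
    Nat.lt_succ_of_le (Finset.le_sup (f := fun x : Site d => dinf x 0) hx)
  have hRpos : 0 < R := Nat.succ_pos _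
  set ρ : ℝ := max (max p (phi nb 0 p S)) (1 / 2) with hρ
  have hρ1 : ρ < 1 := max_lt (max_lt hp1 hφ) (by norm_num)
  have hρ0 : 0 < ρ := lt_of_lt_of_le (by norm_num) (le_max_right _ _)
  have hρp : p ≤ ρ := (le_max_left _ _).trans (le_max_left _ _)
  have hρφ : phi nb 0 p S ≤ ρ := (le_max_right _ _).trans (le_max_left _ _)
  have hlog : Real.log ρ < 0 := Real.log_neg hρ0 hρ1
  have hR0 : (0 : ℝ) < R := by exact_mod_cast hRpos
  refine ⟨-Real.log ρ / (2 * R), by apply div_pos <;> linarith, fun L hL => ?_⟩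
  refine (measure_mono (event_subset L)).trans ?_
  rw [measure_event hp (hπ p hp) (box d L) (fun A => Arm d L ↑A)]
  refine ENNReal.ofReal_le_ofReal ?_
  -- reduce to a power of `ρ`
  have hkey : ∀ k : ℕ, (L : ℝ) ≤ 2 * R * k → ρ ^ k ≤ Real.exp (-(-Real.log ρ / (2 * R)) * L) := by
    intro k hk
    rw [← Real.exp_log hρ0, ← Real.exp_nat_mul, Real.exp_log hρ0, Real.exp_le_exp]
    have : -(-Real.log ρ / (2 * R)) * L = Real.log ρ * (L / (2 * R)) := by
      field_simp
    rw [this, mul_comm]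
    refine mul_le_mul_of_nonpos_left ?_ hlog.le
    rw [div_le_iff₀ (by positivity)]
    linarith
  rcases Nat.lt_or_ge L R with h | h
  · refine (EE_arm_le_p hp L L).trans ?_
    refine hρp.trans ?_
    have := hkey 1 (by
      have : (L : ℝ) ≤ R := by exact_mod_cast h.le
      push_cast
      linarith)
    simpa using this
  · have h1 : L / R * R ≤ L := Nat.div_mul_le_self L R
    have h2 : L ≤ 2 * R * (L / R) := by
      have h3 : 1 ≤ L / R := (Nat.one_le_div_iff hRpos).2 h
      have h4 : L < (L / R + 1) * R := Nat.lt_mul_of_div_lt (Nat.lt_succ_self _) hRpos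
      nlinarith
    refine (EE_arm_mono hp subset_rfl h1).trans ?_
    refine (arm_decay hp hS (fun x hx => hRle x (Finset.mem_union_left _ hx))
      (fun x hx => (hRle x (Finset.mem_union_right _ hx)).le) (L / R) _).trans ?_
    refine (pow_le_pow_left₀ (phi_nonneg hp) hρφ _).trans ?_
    exact hkey _ (by exact_mod_cast h2)

end VoterPerc
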